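/- arXiv:2405.04331 — 2 statements merged into one kernel-verified Lean document; each statement's English description precedes it below -/
import Mathlib

section
/- Let s₀, s₁, p₀ ∈ ℝ² and λ, μ ∈ [0,1]. Set r₀ := s₀ + λ·(p₀ − s₀) and r̃₀ := s₁ + λ·(p₀ − s₁) (so the segment r₀r̃₀ is parallel to s₀s₁), and let r := μ·r₀ + (1−μ)·r̃₀ be any point of the segment [r₀, r̃₀]. Then area(s₀,s₁,r) = area(s₀,p₀,s₁) − √( area(r₀,p₀,r̃₀) · area(s₀,p₀,s₁) ). -/
noncomputable section

/-- The determinant of the 2×2 matrix with columns `v` and `w` in `ℝ²`. -/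
def det2 (v w : ℝ × ℝ) : ℝ := v.1 * w.2 - v.2 * w.1

/-- The area of the triangle with vertices `a`, `b`, `c` in `ℝ²`. -/
def triArea (a b c : ℝ × ℝ) : ℝ := |det2 (b - a) (c - a)| / 2

/-- **Area of cut-off triangles.**
In the triangle `s₀ s₁ p₀`, let `r₀` and `r̃₀` be the points at parameter `λ ∈ [0,1]` on the
segments from `s₀` to `p₀` and from `s₁` to `p₀` respectively (so `r₀ r̃₀` is parallel to
`s₀ s₁`), and let `r` be any point of the segment `[r₀, r̃₀]`.  Then
`area(s₀,s₁,r) = area(s₀,p₀,s₁) − √(area(r₀,p₀,r̃₀)·area(s₀,p₀,s₁))`. -/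
theorem cutoff_triangle_area (s0 s1 p0 r0 rt0 r : ℝ × ℝ) (lam mu : ℝ)
    (hlam : lam ∈ Set.Icc (0:ℝ) 1) (hmu : mu ∈ Set.Icc (0:ℝ) 1)
    (hr0 : r0 = s0 + lam • (p0 - s0)) (hrt0 : rt0 = s1 + lam • (p0 - s1))
    (hr : r = mu • r0 + (1 - mu) • rt0) :
    triArea s0 s1 r =
      triArea s0 p0 s1 - Real.sqrt (triArea r0 p0 rt0 * triArea s0 p0 s1) := by
  obtain ⟨hlam0, hlam1⟩ := hlam
  have hcut : triArea s0 s1 r = lam * triArea s0 p0 s1 := by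
    have h : det2 (s1 - s0) (r - s0) = -(lam * det2 (p0 - s0) (s1 - s0)) := by
      subst hr hr0 hrt0
      simp only [det2, Prod.fst_sub, Prod.snd_sub, Prod.fst_add, Prod.snd_add,
        Prod.smul_fst, Prod.smul_snd, smul_eq_mul]
      ring
    rw [triArea, triArea, h, abs_neg, abs_mul, abs_of_nonneg hlam0, mul_div_assoc]
  have htop : triArea r0 p0 rt0 = (1 - lam) ^ 2 * triArea s0 p0 s1 := by
    have h : det2 (p0 - r0) (rt0 - r0) = (1 - lam) ^ 2 * det2 (p0 - s0) (s1 - s0) := by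
      subst hr0 hrt0
      simp only [det2, Prod.fst_sub, Prod.snd_sub, Prod.fst_add, Prod.snd_add,
        Prod.smul_fst, Prod.smul_snd, smul_eq_mul]
      ring
    rw [triArea, triArea, h, abs_mul, abs_of_nonneg (sq_nonneg _), mul_div_assoc]
  have hA : 0 ≤ triArea s0 p0 s1 := div_nonneg (abs_nonneg _) zero_le_two
  have hsq : triArea r0 p0 rt0 * triArea s0 p0 s1 = ((1 - lam) * triArea s0 p0 s1) ^ 2 := by
    rw [htop]
    ring
  rw [hsq, Real.sqrt_sq (mul_nonneg (sub_nonneg.2 hlam1) hA), hcut]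
  ring

end
end

section
/- Suppose (u, X, Λ₁, Λ_R, λ_cost) is Reinhardt extremal data on an interval (t₁,t₂) such that Λ_R(t) = 0 for all t ∈ (t₁,t₂). Then λ_cost ≠ 0 (the extremal is normal), X(t) = J and Λ₁(t) = (3/2)·λ_cost·J for all t ∈ (t₁,t₂), and u(t) = (1/3, 1/3, 1/3) (the centroid of the control simplex) for almost every t ∈ (t₁,t₂). -/
noncomputable section

open Matrix MeasureTheory

attribute [local instance] Matrix.normedAddCommGroup Matrix.normedSpace

/-- The trace form `⟨A,B⟩ = trace (A·B)` on 2×2 real matrices. -/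
def tf (A B : Matrix (Fin 2) (Fin 2) ℝ) : ℝ := (A * B).trace

/-- The commutator `[A,B] = A·B − B·A`. -/
def brk (A B : Matrix (Fin 2) (Fin 2) ℝ) : Matrix (Fin 2) (Fin 2) ℝ := A * B - B * A

/-- The rotation generator `J = [[0,−1],[1,0]]`. -/
def Jmat : Matrix (Fin 2) (Fin 2) ℝ := !![0, -1; 1, 0]

/-- The control matrix `Z_u` of a control `u = (u₀,u₁,u₂)`. -/
def Zmat (u : Fin 3 → ℝ) : Matrix (Fin 2) (Fin 2) ℝ :=
  !![(u 1 - u 2) / Real.sqrt 3, (u 0 - 2*(u 1) - 2*(u 2)) / 3;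
     u 0, (u 2 - u 1) / Real.sqrt 3]

/-- The normalized control matrix `P = Z_u / ⟨Z_u, X⟩`. -/
def Pmat (u : Fin 3 → ℝ) (X : Matrix (Fin 2) (Fin 2) ℝ) : Matrix (Fin 2) (Fin 2) ℝ :=
  (tf (Zmat u) X)⁻¹ • Zmat u

/-- A traceless matrix that commutes with and is trace-orthogonal to a traceless matrix of
determinant one vanishes. -/
theorem eq_zero_of_brk_eq_zero_of_tf_eq_zero {M X : Matrix (Fin 2) (Fin 2) ℝ}
    (hM : M.trace = 0) (hX : X.trace = 0) (hdet : X.det = 1)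
    (hbrk : brk M X = 0) (htf : tf M X = 0) : M = 0 := by
  have h00 := congrFun (congrFun hbrk 0) 0
  have h01 := congrFun (congrFun hbrk 0) 1
  have h10 := congrFun (congrFun hbrk 1) 0
  simp only [brk, tf, Matrix.trace_fin_two, Matrix.det_fin_two, Matrix.sub_apply,
    Matrix.mul_apply, Fin.sum_univ_two, Matrix.zero_apply] at *
  have hM11 : M 1 1 = -M 0 0 := by linarith
  have hX11 : X 1 1 = -X 0 0 := by linarith
  rw [hX11] at h01 h10 hdet htf
  rw [hM11] at h01 h10 htf
  have h1 : M 0 0 * X 0 1 = M 0 1 * X 0 0 := by linarith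
  have h2 : M 1 0 * X 0 0 = M 0 0 * X 1 0 := by linarith
  have h3 : M 0 1 * X 1 0 = -(M 0 0 * X 0 0) := by linarith
  have h4 : M 1 0 * X 0 1 = -(M 0 0 * X 0 0) := by linarith
  have ha : M 0 0 = 0 := by
    linear_combination (-M 0 0) * hdet - X 1 0 * h1 - X 0 0 * h3
  have hb : M 0 1 = 0 := by
    linear_combination (-M 0 1) * hdet + X 0 0 * h1 - X 0 1 * h3
  have hc : M 1 0 = 0 := by
    linear_combination (-M 1 0) * hdet - X 0 0 * h2 - X 1 0 * h4
  ext i j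
  fin_cases i <;> fin_cases j <;> simp [ha, hb, hc, hM11]

/-- `J` is the only traceless matrix of determinant one that commutes with `J` and pairs
negatively with it. -/
theorem eq_Jmat_of_brk_Jmat_eq_zero {X : Matrix (Fin 2) (Fin 2) ℝ}
    (hX : X.trace = 0) (hdet : X.det = 1) (hneg : tf Jmat X < 0)
    (hbrk : brk Jmat X = 0) : X = Jmat := by
  have h00 := congrFun (congrFun hbrk 0) 0
  have h01 := congrFun (congrFun hbrk 0) 1
  simp [brk, tf, Jmat, Matrix.trace_fin_two, Matrix.det_fin_two,
    Matrix.mul_apply, Matrix.vecMul, dotProduct, Fin.sum_univ_two] at hX hdet hneg h00 h01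
  have ha : X 0 0 = 0 := by linarith
  have hd : X 1 1 = 0 := by linarith
  have hb : X 0 1 = -X 1 0 := by linarith
  rw [ha, hb] at hdet
  have hc : X 1 0 = 1 := by nlinarith
  ext i j
  fin_cases i <;> fin_cases j <;> simp [Jmat, ha, hb, hc, hd]

/-- The centroid of the simplex is the only control whose matrix commutes with `J`. -/
theorem eq_centroid_of_brk_Zmat_Jmat_eq_zero {u : Fin 3 → ℝ} (hsum : u 0 + u 1 + u 2 = 1)
    (hbrk : brk (Zmat u) Jmat = 0) : u = ![1/3, 1/3, 1/3] := by
  have h00 := congrFun (congrFun hbrk 0) 0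
  have h01 := congrFun (congrFun hbrk 0) 1
  simp [brk, Zmat, Jmat] at h00 h01
  have h12 : u 1 = u 2 := by
    have h3 : Real.sqrt 3 ≠ 0 := by positivity
    field_simp at h01
    linarith
  ext i
  fin_cases i <;> simp <;> linarith

/-- A function that is constant on an open interval has zero derivative there. -/
theorem deriv_eq_zero_of_eqOn_Ioo {E : Type*} [NormedAddCommGroup E] [NormedSpace ℝ E]
    {f : ℝ → E} {f' c : E} {a b t : ℝ} (hf : ∀ s ∈ Set.Ioo a b, f s = c)
    (ht : t ∈ Set.Ioo a b) (hd : HasDerivWithinAt f f' (Set.Ioo a b) t) : f' = 0 :=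
  (isOpen_Ioo.uniqueDiffWithinAt ht).eq_deriv _ hd
    ((hasDerivWithinAt_const t _ c).congr hf (hf t ht))

/-- A continuous function on an open interval that is almost everywhere equal to a constant
is equal to it everywhere. -/
theorem eq_const_of_ae_eq_on_Ioo {E : Type*} [TopologicalSpace E] [T2Space E]
    {f : ℝ → E} {c : E} {a b : ℝ} (hf : ContinuousOn f (Set.Ioo a b))
    (h : ∀ᵐ t ∂volume, t ∈ Set.Ioo a b → f t = c) : ∀ t ∈ Set.Ioo a b, f t = c :=
  Measure.eqOn_open_of_ae_eq ((ae_restrict_iff' measurableSet_Ioo).2 h) isOpen_Ioo hf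
    continuousOn_const

/-- **Extremals with `Λ_R ≡ 0` are the singular circular arcs.**
Suppose `(u, X, Λ₁, Λ_R, λ_cost)` is Reinhardt extremal data on `(t₁,t₂)` — a measurable
control with values in the simplex `U_T`, a constant multiplier `λ_cost ≤ 0`, and
(absolutely) continuous `X, Λ₁, Λ_R : (t₁,t₂) → sl₂(ℝ)` with `det X = 1`, `⟨J,X⟩ < 0`,
`⟨Z_u, X⟩ ≠ 0`, nonvanishing costate, satisfying the state/costate ODEs and the vanishing of
the Hamiltonian almost everywhere — and that `Λ_R(t) = 0` for all `t ∈ (t₁,t₂)`.  Then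
`λ_cost ≠ 0`, `X ≡ J`, `Λ₁ ≡ (3/2)·λ_cost·J`, and `u = (1/3,1/3,1/3)` almost everywhere. -/
theorem singular_subarc_is_circular
    (t₁ t₂ : ℝ) (ht : t₁ < t₂)
    (u : ℝ → Fin 3 → ℝ) (lcost : ℝ)
    (X Λ₁ ΛR : ℝ → Matrix (Fin 2) (Fin 2) ℝ)
    (hu_meas : Measurable ((Set.Ioo t₁ t₂).restrict u))
    (hu_mem : ∀ t ∈ Set.Ioo t₁ t₂, (∀ i, 0 ≤ u t i) ∧ u t 0 + u t 1 + u t 2 = 1)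
    (hlcost : lcost ≤ 0)
    (hXc : ContinuousOn X (Set.Ioo t₁ t₂))
    (hΛ₁c : ContinuousOn Λ₁ (Set.Ioo t₁ t₂))
    (hΛRc : ContinuousOn ΛR (Set.Ioo t₁ t₂))
    (hsl2 : ∀ t ∈ Set.Ioo t₁ t₂,
      (X t).trace = 0 ∧ (Λ₁ t).trace = 0 ∧ (ΛR t).trace = 0)
    (hdet : ∀ t ∈ Set.Ioo t₁ t₂, (X t).det = 1)
    (hstar : ∀ t ∈ Set.Ioo t₁ t₂, tf Jmat (X t) < 0)
    (hZX : ∀ t ∈ Set.Ioo t₁ t₂, tf (Zmat (u t)) (X t) ≠ 0)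
    (hcostate : ∀ t ∈ Set.Ioo t₁ t₂, ¬(lcost = 0 ∧ Λ₁ t = 0 ∧ ΛR t = 0))
    (hODE : ∀ᵐ t ∂volume, t ∈ Set.Ioo t₁ t₂ →
      HasDerivWithinAt X (brk (Pmat (u t) (X t)) (X t)) (Set.Ioo t₁ t₂) t ∧
      HasDerivWithinAt Λ₁ (brk (Λ₁ t) (X t)) (Set.Ioo t₁ t₂) t ∧
      HasDerivWithinAt ΛR
        ((brk (Pmat (u t) (X t)) (ΛR t)
            - tf (ΛR t) (Pmat (u t) (X t)) • brk (Pmat (u t) (X t)) (X t))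
          + brk (-Λ₁ t + ((3/2) * lcost) • Jmat) (X t)) (Set.Ioo t₁ t₂) t)
    (hHam : ∀ᵐ t ∂volume, t ∈ Set.Ioo t₁ t₂ →
      tf (Λ₁ t - ((3/2) * lcost) • Jmat) (X t)
        - tf (ΛR t) (Zmat (u t)) / tf (X t) (Zmat (u t)) = 0)
    (hΛR0 : ∀ t ∈ Set.Ioo t₁ t₂, ΛR t = 0) :
    lcost ≠ 0 ∧
    (∀ t ∈ Set.Ioo t₁ t₂, X t = Jmat ∧ Λ₁ t = ((3/2) * lcost) • Jmat) ∧
    (∀ᵐ t ∂volume, t ∈ Set.Ioo t₁ t₂ → u t = ![1/3, 1/3, 1/3]) := by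
  have hΛ₁ : ∀ t ∈ Set.Ioo t₁ t₂, Λ₁ t = ((3/2) * lcost) • Jmat := by
    refine eq_const_of_ae_eq_on_Ioo hΛ₁c ?_
    filter_upwards [hODE, hHam] with t hode hham ht
    have hR := deriv_eq_zero_of_eqOn_Ioo hΛR0 ht (hode ht).2.2
    have hH := hham ht
    simp only [hΛR0 t ht] at hR hH
    rw [← sub_eq_zero]
    refine eq_zero_of_brk_eq_zero_of_tf_eq_zero ?_ (hsl2 t ht).1 (hdet t ht) ?_ ?_
    · simp [(hsl2 t ht).2.1, Jmat, Matrix.trace_fin_two]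
    · have : brk (-Λ₁ t + ((3/2) * lcost) • Jmat) (X t) = 0 := by
        simpa [tf, show ∀ A, brk A 0 = 0 by simp [brk]] using hR
      rw [← neg_eq_zero, ← this]
      simp only [brk]
      noncomm_ring
    · simpa [show ∀ A, tf 0 A = 0 by simp [tf]] using hH
  have hl : lcost ≠ 0 := by
    rintro rfl
    obtain ⟨t, ht⟩ := Set.nonempty_Ioo.2 ht
    exact hcostate t ht ⟨rfl, by simp [hΛ₁ t ht], hΛR0 t ht⟩
  have hX : ∀ t ∈ Set.Ioo t₁ t₂, X t = Jmat := by
    refine eq_const_of_ae_eq_on_Ioo hXc ?_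
    filter_upwards [hODE] with t hode ht
    have h1 := deriv_eq_zero_of_eqOn_Ioo hΛ₁ ht (hode ht).2.1
    refine eq_Jmat_of_brk_Jmat_eq_zero (hsl2 t ht).1 (hdet t ht) (hstar t ht) ?_
    rw [hΛ₁ t ht, brk, Matrix.smul_mul, Matrix.mul_smul, ← smul_sub] at h1
    exact (smul_eq_zero.1 h1).resolve_left (by simpa using hl)
  refine ⟨hl, fun t ht => ⟨hX t ht, hΛ₁ t ht⟩, ?_⟩
  filter_upwards [hODE] with t hode ht
  have h1 := deriv_eq_zero_of_eqOn_Ioo hX ht (hode ht).1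
  refine eq_centroid_of_brk_Zmat_Jmat_eq_zero (hu_mem t ht).2 ?_
  rw [Pmat, brk, Matrix.smul_mul, Matrix.mul_smul, ← smul_sub, hX t ht] at h1
  exact (smul_eq_zero.1 h1).resolve_left (inv_ne_zero (hX t ht ▸ hZX t ht))

end
end
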